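/- Let K be a group with H̃_*(K;ℚ) = 0 (rationally acyclic), let G ≤ K be an infinite cyclic subgroup, and let P = K *_G K. Then H_n(P;ℚ) ≅ H_n(S²;ℚ) for all n, i.e. H_0(P;ℚ) ≅ ℚ, H_2(P;ℚ) ≅ ℚ, and H_n(P;ℚ) = 0 for n ∉ {0,2}. -/

import Mathlib

noncomputable section
namespace GrpHomology

variable (G : Type*) [Group G]

/-- The space of `n`-chains of the (inhomogeneous) bar complex of `G` with rational
coefficients: the free `ℚ`-module on `n`-tuples of group elements. -/
abbrev Chains (n : ℕ) : Type _ := (Fin n → G) →₀ ℚ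

/-- Contraction of an `(m+1)`-tuple at position `i` (multiplying the `i`-th and `(i+1)`-st
entries). -/
def contract {m : ℕ} (x : Fin (m + 1) → G) (i : Fin m) : Fin m → G := fun j =>
  if (j : ℕ) < (i : ℕ) then x j.castSucc
  else if j = i then x i.castSucc * x i.succ
  else x j.succ

/-- The boundary map of the bar complex (with trivial `ℚ`-coefficients):
`d(g₁,…,g_{m+1}) = (g₂,…,g_{m+1}) + Σᵢ (-1)ⁱ (g₁,…,gᵢgᵢ₊₁,…,g_{m+1}) + (-1)^{m+1} (g₁,…,g_m)`. -/
def bdry {m : ℕ} : Chains G (m + 1) →ₗ[ℚ] Chains G m :=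
  Finsupp.lift (Chains G m) ℚ (Fin (m + 1) → G) fun x =>
    Finsupp.single (Fin.tail x) 1
      + (∑ i : Fin m, ((-1 : ℚ) ^ ((i : ℕ) + 1)) • Finsupp.single (contract G x i) (1 : ℚ))
      + ((-1 : ℚ) ^ (m + 1)) • Finsupp.single (Fin.init x) (1 : ℚ)

/-- The cycles in degree `m+1`. -/
def cycles (m : ℕ) : Submodule ℚ (Chains G (m + 1)) := LinearMap.ker (bdry G (m := m))

/-- The boundaries in degree `m+1`, as a submodule of the cycles. -/
def boundaries (m : ℕ) : Submodule ℚ (cycles G m) :=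
  Submodule.comap (cycles G m).subtype (LinearMap.range (bdry G (m := m + 1)))

/-- The group homology `H_{m+1}(G;ℚ)` with rational (trivial) coefficients, as the homology
of the bar complex. -/
def H (m : ℕ) : Type _ := cycles G m ⧸ boundaries G m

instance (m : ℕ) : AddCommGroup (H G m) := by unfold H; infer_instance
instance (m : ℕ) : Module ℚ (H G m) := by unfold H; infer_instance

/-- `H_0(G;ℚ)`: cokernel of `d₁ : C₁ → C₀`. -/
def H0 : Type _ := Chains G 0 ⧸ LinearMap.range (bdry G (m := 0))

instance : AddCommGroup (H0 G) := by unfold H0; infer_instance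
instance : Module ℚ (H0 G) := by unfold H0; infer_instance

end GrpHomology

lemma Monoid.PushoutI.exists_sub_eq_of_base_invariant {H : Type*} [Group H] {G : Bool → Type*}
    [∀ b, Group (G b)] {φ : ∀ b, H →* G b} {M : Type*} [AddCommGroup M] (e : PushoutI φ → M)
    (he : ∀ h x, e (base φ h * x) = e x) :
    ∃ f₁ f₂ : PushoutI φ → M, (∀ a x, f₁ (of true a * x) = f₁ x) ∧
      (∀ a x, f₂ (of false a * x) = f₂ x) ∧ ∀ x, f₁ x - f₂ x = e x := by
  let T (c : PushoutI φ → M) : PushoutI φ →* Equiv.Perm (M × PushoutI φ) :=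
    MonoidHom.toHomPerm
      { toFun := fun p v => (v.1 + (c (p * v.2) - c v.2), p * v.2)
        map_one' := by funext v; simp; rfl
        map_mul' := fun p q => by
          funext v
          refine Prod.ext ?_ (mul_assoc p q v.2)
          change v.1 + (c (p * q * v.2) - c v.2) =
            v.1 + (c (q * v.2) - c v.2) + (c (p * (q * v.2)) - c (q * v.2))
          rw [mul_assoc]
          abel }
  let c : Bool → PushoutI φ → M := fun b => if b then 0 else e
  let Φ : PushoutI φ →* Equiv.Perm (M × PushoutI φ) :=
    lift (fun b => (T (c b)).comp (of b)) ((T 0).comp (base φ)) fun b => by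
      ext h v : 2
      refine Prod.ext ?_ (congrArg (· * v.2) (of_apply_eq_base φ b h))
      change v.1 + (c b (of b (φ b h) * v.2) - c b v.2) = v.1 + (0 - 0)
      rw [of_apply_eq_base]
      cases b <;> simp [c, he]
  have hof (b : Bool) (a : G b) (v : M × PushoutI φ) :
      Φ (of b a) v = (v.1 + (c b (of b a * v.2) - c b v.2), of b a * v.2) := by
    simp only [Φ, lift_of]
    rfl
  have hbase (h : H) (v : M × PushoutI φ) : (Φ (base φ h) v).2 = base φ h * v.2 := by
    rw [← of_apply_eq_base φ true, hof]
  have hsnd (p : PushoutI φ) : ∀ v, (Φ p v).2 = p * v.2 := by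
    induction p using PushoutI.induction_on with
    | of b a => intro v; rw [hof]
    | base h => exact hbase h
    | mul p q hp hq => intro v; rw [map_mul, Equiv.Perm.mul_apply, hp, hq, mul_assoc]
  let f (p : PushoutI φ) : M := (Φ p (0, 1)).1
  have hf (b : Bool) (a : G b) (x : PushoutI φ) :
      f (of b a * x) = f x + (c b (of b a * x) - c b x) := by
    simp only [f]
    rw [map_mul, Equiv.Perm.mul_apply, hof, hsnd, mul_one]
  refine ⟨f, f - e, fun a x => ?_, fun a x => ?_, fun x => ?_⟩
  · simp [hf, c]
  · simp only [Pi.sub_apply, hf, c, Bool.false_eq_true, if_false]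
    abel
  · simp

lemma Monoid.PushoutI.range_of_sup_range_of {H : Type*} [Group H] {G : Bool → Type*}
    [∀ b, Group (G b)] (φ : ∀ b, H →* G b) :
    (of (φ := φ) true).range ⊔ (of (φ := φ) false).range = ⊤ := by
  refine (Subgroup.eq_top_iff' _).2 fun x => ?_
  have hof (b : Bool) (a : G b) :
      of b a ∈ (of (φ := φ) true).range ⊔ (of (φ := φ) false).range := by
    cases b
    · exact Subgroup.mem_sup_right ⟨a, rfl⟩
    · exact Subgroup.mem_sup_left ⟨a, rfl⟩
  induction x using PushoutI.induction_on with
  | of b a => exact hof b a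
  | base h => rw [← of_apply_eq_base φ true]; exact hof _ _
  | mul x y hx hy => exact mul_mem hx hy

namespace GrpHomology

variable {G G' : Type*} [Group G] [Group G']

lemma bdry_single {m : ℕ} (x : Fin (m + 1) → G) (r : ℚ) :
    bdry G (Finsupp.single x r) = Finsupp.single (Fin.tail x) r
      + (∑ i : Fin m, ((-1 : ℚ) ^ ((i : ℕ) + 1)) • Finsupp.single (contract G x i) r)
      + ((-1 : ℚ) ^ (m + 1)) • Finsupp.single (Fin.init x) r := by
  simp [bdry, Finset.smul_sum, mul_comm]

/-- The map induced on chains by a group homomorphism. -/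
def chainsMap (f : G →* G') (n : ℕ) : Chains G n →ₗ[ℚ] Chains G' n :=
  Finsupp.lmapDomain ℚ ℚ (f ∘ ·)

lemma chainsMap_single (f : G →* G') {n : ℕ} (x : Fin n → G) (r : ℚ) :
    chainsMap f n (Finsupp.single x r) = Finsupp.single (f ∘ x) r :=
  Finsupp.mapDomain_single

lemma bdry_chainsMap (f : G →* G') {m : ℕ} (c : Chains G (m + 1)) :
    bdry G' (chainsMap f (m + 1) c) = chainsMap f m (bdry G c) := by
  suffices bdry G' ∘ₗ chainsMap f (m + 1) = chainsMap f m ∘ₗ bdry G from LinearMap.congr_fun this c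
  refine Finsupp.lhom_ext fun x r => ?_
  have hc (i : Fin m) : contract G' (f ∘ x) i = f ∘ contract G x i := by
    funext j
    simp only [contract, Function.comp_apply]
    split_ifs <;> simp
  simp only [LinearMap.comp_apply, chainsMap_single, bdry_single, map_add, map_sum, map_smul, hc]
  rfl

lemma subsingleton_H_iff {m : ℕ} :
    Subsingleton (H G m) ↔ ∀ c, bdry G (m := m) c = 0 → ∃ b, bdry G (m := m + 1) b = c := by
  refine Submodule.Quotient.subsingleton_iff.trans ⟨fun h c hc => ?_, fun h => ?_⟩
  · have : (⟨c, hc⟩ : cycles G m) ∈ boundaries G m := h ▸ Submodule.mem_top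
    exact this
  · exact (Submodule.eq_top_iff').2 fun c => h c c.2

lemma subsingleton_H_of_mulEquiv (e : G ≃* G') {m : ℕ} (h : Subsingleton (H G m)) :
    Subsingleton (H G' m) := by
  rw [subsingleton_H_iff] at h ⊢
  have hinv (n : ℕ) (c : Chains G' n) : chainsMap e.toMonoidHom n
      (chainsMap e.symm.toMonoidHom n c) = c := by
    suffices chainsMap e.toMonoidHom n ∘ₗ chainsMap e.symm.toMonoidHom n = LinearMap.id from
      LinearMap.congr_fun this c
    refine Finsupp.lhom_ext fun x r => ?_
    simp only [LinearMap.comp_apply, chainsMap_single, LinearMap.id_apply]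
    congr 1
    funext i
    simp
  intro c hc
  obtain ⟨b, hb⟩ := h (chainsMap e.symm.toMonoidHom _ c) (by rw [bdry_chainsMap, hc, map_zero])
  exact ⟨chainsMap e.toMonoidHom _ b, by rw [bdry_chainsMap, hb, hinv]⟩

lemma bdry_zero : bdry G (m := 0) = 0 := by
  refine Finsupp.lhom_ext fun x r => ?_
  rw [bdry_single]
  simp [Subsingleton.elim (Fin.init x) (Fin.tail x)]

/-- `H_0(G;ℚ) ≅ ℚ`. -/
def H0Equiv (G : Type*) [Group G] : H0 G ≃ₗ[ℚ] ℚ :=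
  (Submodule.quotEquivOfEqBot _ (by rw [bdry_zero, LinearMap.range_zero])).trans
    (Finsupp.uniqueLinearEquiv ℚ ℚ (default : Fin 0 → G))

lemma bdry_pair (x y : G) : bdry G (Finsupp.single ![x, y] 1) =
    Finsupp.single ![y] 1 - Finsupp.single ![x * y] 1 + Finsupp.single ![x] 1 := by
  rw [bdry_single]
  have h₁ : Fin.tail ![x, y] = ![y] := by funext i; fin_cases i; rfl
  have h₂ : Fin.init ![x, y] = ![x] := by funext i; fin_cases i; rfl
  have h₃ : contract G ![x, y] 0 = ![x * y] := by funext i; fin_cases i; rfl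
  simp [h₁, h₂, h₃, sub_eq_add_neg]

lemma single_mul_mem_range {x y : G}
    (hx : Finsupp.single ![x] (1 : ℚ) ∈ LinearMap.range (bdry G (m := 1)))
    (hy : Finsupp.single ![y] (1 : ℚ) ∈ LinearMap.range (bdry G (m := 1))) :
    Finsupp.single ![x * y] (1 : ℚ) ∈ LinearMap.range (bdry G (m := 1)) := by
  have h : Finsupp.single ![x * y] (1 : ℚ) = Finsupp.single ![y] 1 + Finsupp.single ![x] 1 -
      bdry G (Finsupp.single ![x, y] 1) := by
    rw [bdry_pair]
    abel
  rw [h]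
  exact sub_mem (add_mem hy hx) ⟨_, rfl⟩

lemma subsingleton_H_zero_iff : Subsingleton (H G 0) ↔
    ∀ x : G, Finsupp.single ![x] (1 : ℚ) ∈ LinearMap.range (bdry G (m := 1)) := by
  rw [subsingleton_H_iff]
  refine ⟨fun h x => h _ (by rw [bdry_zero, LinearMap.zero_apply]), fun h c _ => ?_⟩
  change c ∈ LinearMap.range _
  induction c using Finsupp.induction_linear with
  | zero => exact zero_mem _
  | add a b ha hb =>
    exact add_mem (ha (by rw [bdry_zero, LinearMap.zero_apply]))
      (hb (by rw [bdry_zero, LinearMap.zero_apply]))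
  | single x r =>
    have hx : x = ![x 0] := by funext i; fin_cases i; rfl
    rw [hx, ← mul_one r, ← smul_eq_mul, ← Finsupp.smul_single]
    exact Submodule.smul_mem _ _ (h _)

lemma single_map_mem_range (f : G →* G') (h : Subsingleton (H G 0)) (x : G) :
    Finsupp.single ![f x] (1 : ℚ) ∈ LinearMap.range (bdry G' (m := 1)) := by
  obtain ⟨b, hb⟩ := subsingleton_H_zero_iff.1 h x
  refine ⟨chainsMap f _ b, ?_⟩
  rw [bdry_chainsMap, hb, chainsMap_single]
  congr 1
  funext i
  fin_cases i
  rfl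

open Monoid in
lemma subsingleton_H_zero_pushoutI {ι H' : Type*} [Nonempty ι] [Group H'] {K : ι → Type*}
    [∀ i, Group (K i)] (φ : ∀ i, H' →* K i) (h : ∀ i, Subsingleton (H (K i) 0)) :
    Subsingleton (H (PushoutI φ) 0) := by
  refine subsingleton_H_zero_iff.2 fun x => ?_
  induction x using PushoutI.induction_on with
  | of i a => exact single_map_mem_range (PushoutI.of (φ := φ) i) (h i) a
  | base b =>
    obtain ⟨i⟩ := ‹Nonempty ι›
    rw [← PushoutI.of_apply_eq_base φ i]
    exact single_map_mem_range (PushoutI.of (φ := φ) i) (h i) _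
  | mul x y hx hy => exact single_mul_mem_range hx hy

end GrpHomology

section

open CategoryTheory Limits groupHomology

universe u

lemma Rep.shortExact_of_injective_surjective {k P : Type u} [CommRing k] [Group P]
    (X : ShortComplex (Rep.{u} k P)) (hf : Function.Injective X.f.hom)
    (hg : Function.Surjective X.g.hom) (h : ∀ x, X.g.hom x = 0 → ∃ y, X.f.hom y = x) :
    X.ShortExact := by
  have : Mono X.f := (Rep.mono_iff_injective _).2 hf
  have : Epi X.g := (Rep.epi_iff_surjective _).2 hg
  refine ShortComplex.ShortExact.mk ?_
  rw [← ShortComplex.exact_map_iff_of_faithful X (forget₂ (Rep.{u} k P) (ModuleCat.{u} k)),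
    ShortComplex.moduleCat_exact_iff]
  exact h

namespace PermRep
variable {k P : Type u} [CommRing k] [Group P]

/-- The permutation representation `k[S \ P]`, realised as the representation induced from the
trivial representation of `S`. -/
abbrev indTrivial (k : Type u) [CommRing k] (S : Subgroup P) : Rep.{u} k P :=
  Rep.ind.{u, u, u, u} S.subtype (Rep.trivial k S k)

/-- The basis vector of `k[S \ P]` given by the coset `S h`. -/
def coset (k : Type u) [CommRing k] (S : Subgroup P) (h : P) : indTrivial k S :=
  Representation.IndV.mk S.subtype (Rep.trivial k S k).ρ h (1 : k)

lemma coset_mul {S : Subgroup P} {s : P} (hs : s ∈ S) (h : P) :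
    coset k S (s * h) = coset k S h := by
  have := Representation.Coinvariants.mk_self_apply (Representation.tprod
    ((Representation.leftRegular k P).comp S.subtype) (Rep.trivial k S k).ρ) ⟨s, hs⟩
    ((MonoidAlgebra.single h 1) ⊗ₜ[k] (1 : k))
  simpa [coset] using this

lemma rho_coset (S : Subgroup P) (p h : P) :
    (indTrivial k S).ρ p (coset k S h) = coset k S (h * p⁻¹) :=
  Representation.ind_mk _ _ _ _ _

section lift

variable (S : Subgroup P) {M : Type*} [AddCommGroup M] [Module k M]

variable {S} in
lemma linearMap_ext {f g : indTrivial k S →ₗ[k] M} (h : ∀ x, f (coset k S x) = g (coset k S x)) :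
    f = g :=
  Representation.IndV.hom_ext _ _ fun x => LinearMap.ext_ring (h x)

/-- The linear map out of `k[S \ P]` determined by an `S`-invariant function on `P`. -/
def lift (f : P → M) (hf : ∀ s ∈ S, ∀ x, f (s * x) = f x) : indTrivial k S →ₗ[k] M :=
  Representation.Coinvariants.lift _
    (TensorProduct.lift <| (Finsupp.lift _ _ _ fun x => LinearMap.toSpanSingleton k M (f x)) ∘ₗ
      (MonoidAlgebra.coeffLinearEquiv k).toLinearMap)
    fun s => by
      ext h
      simp [hf s s.2]

@[simp]
lemma lift_coset (f : P → M) (hf : ∀ s ∈ S, ∀ x, f (s * x) = f x) (x : P) :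
    lift (k := k) S f hf (coset k S x) = f x := by
  simp [lift, coset]

/-- The morphism of representations out of `k[S \ P]` determined by an `S`-invariant and
`P`-equivariant function on `P`. -/
def liftHom (S : Subgroup P) (M : Rep.{u} k P) (f : P → M) (hf : ∀ s ∈ S, ∀ x, f (s * x) = f x)
    (hρ : ∀ p x, f (x * p⁻¹) = M.ρ p (f x)) : indTrivial k S ⟶ M :=
  Rep.ofHom ⟨lift S f hf, fun p => linearMap_ext fun x => by
    simp only [LinearMap.comp_apply]
    rw [lift_coset, ← hρ, rho_coset, lift_coset]⟩

@[simp]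
lemma liftHom_coset (S : Subgroup P) (M : Rep.{u} k P) (f : P → M)
    (hf : ∀ s ∈ S, ∀ x, f (s * x) = f x) (hρ : ∀ p x, f (x * p⁻¹) = M.ρ p (f x)) (x : P) :
    (liftHom S M f hf hρ).hom (coset k S x) = f x :=
  lift_coset S f hf x

lemma hom_ext {S : Subgroup P} {M : Rep.{u} k P} {f g : indTrivial k S ⟶ M}
    (h : ∀ x, f.hom (coset k S x) = g.hom (coset k S x)) : f = g :=
  Rep.hom_ext <| Representation.IntertwiningMap.toLinearMap_injective _ _ <| linearMap_ext h

end lift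

/-- The augmentation `k[S \ P] ⟶ k`. -/
def augmentation (k : Type u) [CommRing k] (S : Subgroup P) :
    indTrivial k S ⟶ Rep.trivial k P k :=
  liftHom S (Rep.trivial k P k) (fun _ => (1 : k)) (fun _ _ _ => rfl) (fun _ _ => rfl)

@[simp]
lemma augmentation_coset (S : Subgroup P) (x : P) :
    (augmentation k S).hom (coset k S x) = (1 : k) :=
  liftHom_coset ..

section tree

variable {S S₁ S₂ : Subgroup P}

/-- The projection `k[S \ P] ⟶ k[T \ P]` for `S ≤ T`. -/
def proj (k : Type u) [CommRing k] {S T : Subgroup P} (h : S ≤ T) :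
    indTrivial k S ⟶ indTrivial k T :=
  liftHom S (indTrivial k T) (coset k T) (fun _ hs x => coset_mul (h hs) x)
    (fun p x => (rho_coset T p x).symm)

@[simp]
lemma proj_coset {S T : Subgroup P} (h : S ≤ T) (x : P) :
    (proj k h).hom (coset k S x) = coset k T x :=
  liftHom_coset ..

/-- The direct sum of two representations, with underlying module the product. -/
abbrev prodRep (A B : Rep.{u} k P) : Rep.{u} k P := Rep.of (A.ρ.prod B.ρ)

/-- The sequence `0 ⟶ k[S \ P] ⟶ k[S₁ \ P] ⊕ k[S₂ \ P] ⟶ k ⟶ 0` for `S ≤ S₁, S₂`. When `P` is the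
amalgam of `S₁` and `S₂` over `S`, this is the augmented chain complex of the Bass–Serre tree. -/
def treeComplex (k : Type u) [CommRing k] (h₁ : S ≤ S₁) (h₂ : S ≤ S₂) :
    ShortComplex (Rep.{u} k P) where
  X₁ := indTrivial k S
  X₂ := prodRep (indTrivial k S₁) (indTrivial k S₂)
  X₃ := Rep.trivial k P k
  f := Rep.ofHom ⟨(proj k h₁).hom.toLinearMap.prod (proj k h₂).hom.toLinearMap, fun p =>
    LinearMap.ext fun x => Prod.ext (Rep.hom_comm_apply (proj k h₁) p x)
      (Rep.hom_comm_apply (proj k h₂) p x)⟩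
  g := Rep.ofHom ⟨(augmentation k S₁).hom.toLinearMap.coprod
      (-(augmentation k S₂).hom.toLinearMap), fun p => LinearMap.ext fun x =>
    congrArg₂ (fun a b : k => a + -b) (Rep.hom_comm_apply (augmentation k S₁) p x.1)
      (Rep.hom_comm_apply (augmentation k S₂) p x.2)⟩
  zero := hom_ext fun x => by
    change (augmentation k S₁).hom ((proj k h₁).hom (coset k S x)) +
      -(augmentation k S₂).hom ((proj k h₂).hom (coset k S x)) = (0 : k)
    rw [proj_coset, proj_coset, augmentation_coset, augmentation_coset, add_neg_cancel]

lemma treeComplex_f_apply (h₁ : S ≤ S₁) (h₂ : S ≤ S₂) (v : indTrivial k S) :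
    (treeComplex k h₁ h₂).f.hom v = ((proj k h₁).hom v, (proj k h₂).hom v) := rfl

lemma treeComplex_g_apply (h₁ : S ≤ S₁) (h₂ : S ≤ S₂)
    (v : indTrivial k S₁ × indTrivial k S₂) :
    (treeComplex k h₁ h₂).g.hom v =
      (augmentation k S₁).hom v.1 + -((augmentation k S₂).hom v.2 : k) := rfl

lemma eq_of_invariant_of_sup_eq_top (hsup : S₁ ⊔ S₂ = ⊤) {M : Type*} (c : P → M)
    (hc₁ : ∀ s ∈ S₁, ∀ x, c (s * x) = c x) (hc₂ : ∀ s ∈ S₂, ∀ x, c (s * x) = c x) (x : P) :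
    c x = c 1 := by
  have hx : x ∈ Subgroup.closure ((S₁ : Set P) ∪ S₂) := by
    rw [Subgroup.closure_union, Subgroup.closure_eq, Subgroup.closure_eq, hsup]
    exact Subgroup.mem_top x
  suffices ∀ y, c (x * y) = c y by simpa using this 1
  induction hx using Subgroup.closure_induction with
  | mem s hs => exact hs.elim (hc₁ s) (hc₂ s)
  | one => simp
  | mul a b _ _ ha hb => intro y; rw [mul_assoc, ha, hb]
  | inv a _ ha => intro y; rw [← ha, mul_inv_cancel_left]

lemma treeComplex_shortExact (h₁ : S ≤ S₁) (h₂ : S ≤ S₂) (hsup : S₁ ⊔ S₂ = ⊤)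
    (hsplit : ∃ f₁ f₂ : P → indTrivial k S, (∀ s ∈ S₁, ∀ x, f₁ (s * x) = f₁ x) ∧
      (∀ s ∈ S₂, ∀ x, f₂ (s * x) = f₂ x) ∧ ∀ x, f₁ x - f₂ x = coset k S x) :
    (treeComplex k h₁ h₂).ShortExact := by
  refine Rep.shortExact_of_injective_surjective _ ?_ ?_ ?_
  · obtain ⟨f₁, f₂, hf₁, hf₂, hf⟩ := hsplit
    have key : (lift S₁ f₁ hf₁) ∘ₗ (proj k h₁).hom.toLinearMap -
        (lift S₂ f₂ hf₂) ∘ₗ (proj k h₂).hom.toLinearMap = LinearMap.id := by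
      refine linearMap_ext fun x => ?_
      change lift S₁ f₁ hf₁ ((proj k h₁).hom (coset k S x)) -
        lift S₂ f₂ hf₂ ((proj k h₂).hom (coset k S x)) = coset k S x
      rw [proj_coset, proj_coset, lift_coset, lift_coset, hf]
    refine Function.LeftInverse.injective
      (g := fun v : indTrivial k S₁ × indTrivial k S₂ =>
        lift S₁ f₁ hf₁ v.1 - lift S₂ f₂ hf₂ v.2) fun v => ?_
    exact LinearMap.congr_fun key v
  · intro r
    change k at r
    refine ⟨(r • coset k S₁ 1, 0), (treeComplex_g_apply h₁ h₂ _).trans ?_⟩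
    rw [map_smul, map_zero, augmentation_coset]
    change r * 1 + -0 = r
    ring
  · intro v hv
    change indTrivial k S₁ × indTrivial k S₂ at v
    rw [treeComplex_g_apply] at hv
    let R := LinearMap.range (treeComplex k h₁ h₂).f.hom.toLinearMap
    let q : (indTrivial k S₁ × indTrivial k S₂) →ₗ[k] _ := R.mkQ
    let c : P → _ := fun x => q (coset k S₁ x, 0)
    have hc (x : P) : c x = - q (0, coset k S₂ x) := by
      rw [eq_neg_iff_add_eq_zero, ← map_add, Prod.mk_add_mk, add_zero, zero_add]
      refine (Submodule.Quotient.mk_eq_zero _).2 ⟨coset k S x, ?_⟩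
      refine (treeComplex_f_apply h₁ h₂ _).trans ?_
      rw [proj_coset, proj_coset]
    have hconst := eq_of_invariant_of_sup_eq_top hsup c
      (fun s hs x => by simp only [c, coset_mul hs]) (fun s hs x => by simp only [hc, coset_mul hs])
    have e₁ : q ∘ₗ LinearMap.inl k _ _ =
        LinearMap.toSpanSingleton k _ (c 1) ∘ₗ (augmentation k S₁).hom.toLinearMap :=
      linearMap_ext fun x => by
        change c x = ((augmentation k S₁).hom (coset k S₁ x) : k) • c 1
        rw [augmentation_coset, one_smul, hconst x]
    have e₂ : q ∘ₗ LinearMap.inr k _ _ =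
        -(LinearMap.toSpanSingleton k _ (c 1) ∘ₗ (augmentation k S₂).hom.toLinearMap) :=
      linearMap_ext fun x => by
        change q (0, coset k S₂ x) = -(((augmentation k S₂).hom (coset k S₂ x) : k) • c 1)
        rw [augmentation_coset, one_smul, ← hconst x, hc, neg_neg]
    have hq : q v = 0 := by
      have : v = LinearMap.inl k _ _ v.1 + LinearMap.inr k _ _ v.2 := by simp
      rw [this, map_add]
      have e₁' := LinearMap.congr_fun e₁ v.1
      have e₂' := LinearMap.congr_fun e₂ v.2
      change q _ = ((augmentation k S₁).hom v.1 : k) • c 1 at e₁'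
      change q _ = -(((augmentation k S₂).hom v.2 : k) • c 1) at e₂'
      rw [e₁', e₂', ← neg_smul, ← add_smul, hv]
      exact zero_smul k _
    exact (Submodule.Quotient.mk_eq_zero R).1 hq

end tree

section cyclic

/-- Left translation by `p` minus the identity, as an endomorphism of the regular representation. -/
def translateSubOne (k : Type u) [CommRing k] (p : P) :
    indTrivial k (⊥ : Subgroup P) ⟶ indTrivial k (⊥ : Subgroup P) :=
  liftHom ⊥ _ (fun x => coset k ⊥ (p * x) - coset k ⊥ x)
    (fun s hs x => by rw [Subgroup.mem_bot.1 hs, one_mul])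
    (fun q x => by rw [map_sub, rho_coset, rho_coset, mul_assoc])

@[simp]
lemma translateSubOne_coset (p x : P) :
    (translateSubOne k p).hom (coset k ⊥ x) = coset k ⊥ (p * x) - coset k ⊥ x :=
  liftHom_coset ..

/-- The sequence `0 ⟶ k[P] ⟶ k[P] ⟶ k[⟨p⟩ \ P] ⟶ 0` whose first map is translation by `p` minus the
identity. -/
def cyclicComplex (k : Type u) [CommRing k] (p : P) : ShortComplex (Rep.{u} k P) where
  X₁ := indTrivial k (⊥ : Subgroup P)
  X₂ := indTrivial k (⊥ : Subgroup P)
  X₃ := indTrivial k (Subgroup.zpowers p)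
  f := translateSubOne k p
  g := proj k bot_le
  zero := hom_ext fun x => by
    change (proj k bot_le).hom ((translateSubOne k p).hom (coset k ⊥ x)) = 0
    rw [translateSubOne_coset, map_sub, proj_coset, proj_coset,
      coset_mul (Subgroup.mem_zpowers p), sub_self]

lemma finsupp_eq_zero_of_translate_eq {M : Type*} [Zero M] {p : P} (hp : ¬IsOfFinOrder p)
    (u : P →₀ M) (hu : ∀ x, u (p * x) = u x) : u = 0 := by
  by_contra h
  obtain ⟨x, hx⟩ := Finsupp.ne_iff.1 h
  have hpow : ∀ n : ℕ, u (p ^ n * x) = u x := by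
    intro n
    induction n with
    | zero => simp
    | succ n ih => rw [pow_succ', mul_assoc, hu, ih]
  have hinj : Function.Injective fun n : ℕ => p ^ n * x := fun m n hmn =>
    (injective_pow_iff_not_isOfFinOrder.2 hp) (mul_right_cancel hmn)
  exact Set.infinite_of_injective_forall_mem hinj
    (s := (u.support : Set P)) (fun n => by simpa [hpow n] using hx) u.support.finite_toSet

lemma translateSubOne_injective {p : P} (hp : ¬IsOfFinOrder p) :
    Function.Injective (translateSubOne k p).hom := by
  let F : indTrivial k (⊥ : Subgroup P) →ₗ[k] (P →₀ k) := lift ⊥ (fun x => Finsupp.single x 1)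
    (fun s hs x => by rw [Subgroup.mem_bot.1 hs, one_mul])
  have hF : Function.Injective F := by
    have : (Finsupp.lift _ k P (coset k ⊥)) ∘ₗ F = LinearMap.id :=
      linearMap_ext fun x => by
        rw [LinearMap.comp_apply, lift_coset, LinearMap.id_apply]
        simp
    exact Function.LeftInverse.injective (g := Finsupp.lift _ k P (coset k ⊥))
      (LinearMap.congr_fun this)
  have hcomm : F ∘ₗ (translateSubOne k p).hom.toLinearMap =
      (Finsupp.lmapDomain k k (p * ·) - LinearMap.id) ∘ₗ F :=
    linearMap_ext fun x => by
      change F ((translateSubOne k p).hom (coset k ⊥ x)) =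
        Finsupp.mapDomain (p * ·) (F (coset k ⊥ x)) - F (coset k ⊥ x)
      rw [translateSubOne_coset, map_sub, lift_coset, lift_coset, Finsupp.mapDomain_single]
  refine (injective_iff_map_eq_zero _).2 fun v hv => hF ?_
  rw [map_zero]
  refine finsupp_eq_zero_of_translate_eq hp _ fun x => ?_
  have h := LinearMap.congr_fun hcomm v
  change F ((translateSubOne k p).hom v) = Finsupp.mapDomain (p * ·) (F v) - F v at h
  rw [hv, map_zero, eq_comm, sub_eq_zero] at h
  rw [← h, Finsupp.mapDomain_apply (mul_right_injective p), h]

lemma cyclicComplex_shortExact {p : P} (hp : ¬IsOfFinOrder p) :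
    (cyclicComplex k p).ShortExact := by
  refine Rep.shortExact_of_injective_surjective _ (translateSubOne_injective hp) ?_ ?_
  · let s : indTrivial k (Subgroup.zpowers p) →ₗ[k] _ ⧸
        LinearMap.range (proj k (bot_le : ⊥ ≤ Subgroup.zpowers p)).hom.toLinearMap :=
      Submodule.mkQ _
    have : s = 0 := linearMap_ext fun x =>
      (Submodule.Quotient.mk_eq_zero _).2 ⟨coset k ⊥ x, proj_coset bot_le x⟩
    intro v
    exact (Submodule.Quotient.mk_eq_zero _).1 (LinearMap.congr_fun this v)
  · intro v hv
    let R := LinearMap.range (translateSubOne k p).hom.toLinearMap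
    let q : indTrivial k (⊥ : Subgroup P) →ₗ[k] _ := R.mkQ
    have hq (x : P) : q (coset k ⊥ (p * x)) = q (coset k ⊥ x) := by
      rw [← sub_eq_zero, ← map_sub]
      exact (Submodule.Quotient.mk_eq_zero _).2 ⟨coset k ⊥ x, translateSubOne_coset p x⟩
    let r := lift (k := k) (Subgroup.zpowers p) (fun x => q (coset k ⊥ x)) fun s hs => by
      obtain ⟨n, rfl⟩ := hs
      refine zpow_induction_left (P := fun s => ∀ x, q (coset k ⊥ (s * x)) = q (coset k ⊥ x))
        (fun x => by rw [one_mul]) (fun a ha x => ?_) (fun a ha x => ?_) n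
      · rw [mul_assoc, hq, ha]
      · rw [mul_assoc, ← hq, mul_inv_cancel_left, ha]
    have hr : r ∘ₗ (proj k bot_le).hom.toLinearMap = q := linearMap_ext fun x => by
      change r ((proj k bot_le).hom (coset k ⊥ x)) = _
      rw [proj_coset, lift_coset]
    refine (Submodule.Quotient.mk_eq_zero R).1 ?_
    change q v = 0
    rw [← hr]
    change r ((cyclicComplex k p).g.hom v) = 0
    rw [hv]
    exact map_zero r

end cyclic

end PermRep

lemma isZero_groupHomology_prodRep {P : Type} [Group P] (A B : Rep.{0} ℚ P) (n : ℕ)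
    (hA : IsZero (groupHomology A n)) (hB : IsZero (groupHomology B n)) :
    IsZero (groupHomology (PermRep.prodRep A B) n) := by
  let X : ShortComplex (Rep.{0} ℚ P) :=
    { X₁ := A
      X₂ := PermRep.prodRep A B
      X₃ := B
      f := Rep.ofHom ⟨LinearMap.inl ℚ A B, fun p => LinearMap.ext fun x =>
        Prod.ext rfl (map_zero (B.ρ p)).symm⟩
      g := Rep.ofHom ⟨LinearMap.snd ℚ A B, fun p => rfl⟩
      zero := rfl }
  have hX : X.ShortExact := Rep.shortExact_of_injective_surjective X LinearMap.inl_injective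
    LinearMap.snd_surjective fun x hx => ⟨x.1, Prod.ext rfl hx.symm⟩
  exact (mapShortComplex₂_exact hX n).isZero_of_both_zeros
    (hA.eq_of_src _ _) (hB.eq_of_tgt _ _)

lemma functor_map_eq_zero_of_coinvariants {k P : Type} [CommRing k] [Group P] {A B : Rep.{0} k P}
    (φ : A ⟶ B) (h : Representation.Coinvariants.mk B.ρ ∘ₗ φ.hom.toLinearMap = 0) :
    (functor k P 0).map φ = 0 := by
  have h₀ : φ.toModuleCatHom ≫ (Rep.coinvariantsMk k P).app B = 0 := ModuleCat.hom_ext h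
  have h₁ : H0π A ≫ (functor k P 0).map φ = φ.toModuleCatHom ≫ H0π B :=
    H0π_comp_map (MonoidHom.id P) φ
  have h₂ : H0π A ≫ (functor k P 0).map φ = 0 := by
    rw [h₁, ← coinvariantsMk_comp_H0Iso_inv, ← Category.assoc, h₀, zero_comp]
    rfl
  exact (cancel_epi (H0π A)).1 (h₂.trans comp_zero.symm)

namespace PermRep
variable {P : Type} [Group P]

/-- The Shapiro isomorphism for the permutation representation `ℚ[S \ P]`. -/
def groupHomologyIndTrivialIso (S : Subgroup P) (n : ℕ) :
    groupHomology (indTrivial ℚ S) n ≅ groupHomology (Rep.trivial ℚ S ℚ) n :=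
  haveI := Classical.decEq P
  indIso S (Rep.trivial ℚ S ℚ) n

lemma isZero_groupHomology_indTrivial_bot (n : ℕ) :
    IsZero (groupHomology (indTrivial ℚ (⊥ : Subgroup P)) (n + 1)) :=
  (isZero_groupHomology_succ_of_subsingleton _ n).of_iso (groupHomologyIndTrivialIso ⊥ (n + 1))

lemma coinvariants_mk_comp_translateSubOne (p : P) :
    Representation.Coinvariants.mk (indTrivial ℚ (⊥ : Subgroup P)).ρ ∘ₗ
      (translateSubOne ℚ p).hom.toLinearMap = 0 := by
  refine linearMap_ext fun x => ?_
  change Representation.Coinvariants.mk _ ((translateSubOne ℚ p).hom (coset ℚ ⊥ x)) = 0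
  have h : coset ℚ ⊥ (p * x) = (indTrivial ℚ (⊥ : Subgroup P)).ρ (x⁻¹ * p⁻¹ * x) (coset ℚ ⊥ x) := by
    rw [rho_coset]
    congr 1
    group
  rw [translateSubOne_coset, h]
  exact (Representation.Coinvariants.mk_eq_zero _).2 (Representation.Coinvariants.sub_mem_ker _ _)

lemma map_translateSubOne_zero (p : P) : (functor ℚ P 0).map (translateSubOne ℚ p) = 0 :=
  functor_map_eq_zero_of_coinvariants _ (coinvariants_mk_comp_translateSubOne p)

lemma isZero_groupHomology_indTrivial_zpowers {p : P} (hp : ¬IsOfFinOrder p) (n : ℕ) :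
    IsZero (groupHomology (indTrivial ℚ (Subgroup.zpowers p)) (n + 2)) := by
  exact (mapShortComplex₃_exact (cyclicComplex_shortExact (k := ℚ) hp) (i := n + 2) (j := n + 1)
    rfl).isZero_of_both_zeros ((isZero_groupHomology_indTrivial_bot (n + 1)).eq_of_src _ _)
    ((isZero_groupHomology_indTrivial_bot n).eq_of_tgt _ _)

lemma isIso_δ_cyclicComplex {p : P} (hp : ¬IsOfFinOrder p) :
    IsIso (δ (cyclicComplex_shortExact (k := ℚ) hp) 1 0 rfl) := by
  have := mono_δ_of_isZero (cyclicComplex_shortExact (k := ℚ) hp) 0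
    (isZero_groupHomology_indTrivial_bot 0)
  have : Epi (δ (cyclicComplex_shortExact (k := ℚ) hp) 1 0 rfl) :=
    (mapShortComplex₁_exact (cyclicComplex_shortExact (k := ℚ) hp) (i := 1) (j := 0) rfl).epi_f
      (map_translateSubOne_zero p)
  exact isIso_of_mono_of_epi _

/-- `H₁(P; ℚ[⟨p⟩ \ P]) ≅ ℚ` for `p` of infinite order. -/
def groupHomologyIndTrivialZpowersOneIso {p : P} (hp : ¬IsOfFinOrder p) :
    groupHomology (indTrivial ℚ (Subgroup.zpowers p)) 1 ≅ ModuleCat.of ℚ ℚ :=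
  @asIso _ _ _ _ _ (isIso_δ_cyclicComplex hp) ≪≫ groupHomologyIndTrivialIso ⊥ 0 ≪≫
    H0IsoOfIsTrivial (Rep.trivial ℚ (⊥ : Subgroup P) ℚ)

end PermRep

namespace GrpHomology
variable {G : Type} [Group G]

lemma inhomogeneousChains_d_trivial (m : ℕ) :
    groupHomology.inhomogeneousChains.d (Rep.trivial ℚ G ℚ) m = ModuleCat.ofHom (bdry G) := by
  refine ModuleCat.hom_ext (Finsupp.lhom_ext fun x r => ?_)
  have h₁ (i : Fin m) : Fin.contractNth i.castSucc (· * ·) x = contract G x i := by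
    funext j
    simp only [Fin.contractNth, contract, Fin.val_castSucc, Fin.ext_iff]
    split_ifs with _ h
    · rfl
    · rw [Fin.ext h]
    · rfl
  have h₂ : Fin.contractNth (Fin.last m) (· * ·) x = Fin.init x := by
    funext j
    simp [Fin.contractNth, Fin.init]
  refine (groupHomology.inhomogeneousChains.d_single m x r).trans ?_
  refine Eq.trans ?_ (bdry_single x r).symm
  rw [Fin.sum_univ_castSucc, add_assoc]
  simp only [h₁, h₂]
  rfl

/-- The bar complex with trivial rational coefficients in degrees `m + 2`, `m + 1`, `m`. -/
def barShortComplex (G : Type) [Group G] (m : ℕ) : ShortComplex (ModuleCat.{0} ℚ) :=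
  ShortComplex.mk (ModuleCat.ofHom (bdry G (m := m + 1))) (ModuleCat.ofHom (bdry G (m := m))) (by
    rw [← inhomogeneousChains_d_trivial, ← inhomogeneousChains_d_trivial,
      groupHomology.inhomogeneousChains.d_comp_d])

/-- The bar complex agrees with the complex of inhomogeneous chains of the trivial representation. -/
def barShortComplexIso (G : Type) [Group G] (m : ℕ) :
    (groupHomology.inhomogeneousChains (Rep.trivial ℚ G ℚ)).sc' (m + 2) (m + 1) m ≅
      barShortComplex G m :=
  ShortComplex.isoMk (Iso.refl _) (Iso.refl _) (Iso.refl _)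
    (((Category.id_comp _).trans (((groupHomology.inhomogeneousChains.d_def _ (m + 1)).trans
      (inhomogeneousChains_d_trivial _)).symm)).trans (Category.comp_id _).symm)
    (((Category.id_comp _).trans (((groupHomology.inhomogeneousChains.d_def _ m).trans
      (inhomogeneousChains_d_trivial _)).symm)).trans (Category.comp_id _).symm)

/-- The group homology defined in Mathlib agrees with `GrpHomology.H`. -/
def groupHomologyEquiv (G : Type) [Group G] (m : ℕ) :
    groupHomology (Rep.trivial ℚ G ℚ) (m + 1) ≃ₗ[ℚ] H G m :=
  ((HomologicalComplex.homologyIsoSc' _ (m + 2) (m + 1) m (by simp) (by simp)) ≪≫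
    ShortComplex.homologyMapIso (barShortComplexIso G m) ≪≫
    (barShortComplex G m).moduleCatHomologyIso).toLinearEquiv.trans
    (Submodule.quotEquivOfEq _ _ (by
      ext x
      exact exists_congr fun y => Subtype.ext_iff))
end GrpHomology

open GrpHomology PermRep in
/-- If `P` has subgroups `S₁`, `S₂` that are rationally acyclic in positive degrees and whose tree
complex over `S` is exact, then `H_{n+2}(P; ℚ) ≅ H_{n+1}(P; ℚ[S \ P])`. -/
lemma isIso_δ_treeComplex {P : Type} [Group P] {S S₁ S₂ : Subgroup P} {h₁ : S ≤ S₁} {h₂ : S ≤ S₂}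
    (hX : (treeComplex ℚ h₁ h₂).ShortExact) (hS₁ : ∀ m, Subsingleton (GrpHomology.H S₁ m))
    (hS₂ : ∀ m, Subsingleton (GrpHomology.H S₂ m)) (n : ℕ) :
    IsIso (δ hX (n + 2) (n + 1) rfl) := by
  have hz {T : Subgroup P} (hT : ∀ m, Subsingleton (GrpHomology.H T m)) (m : ℕ) :
      IsZero (groupHomology (indTrivial ℚ T) (m + 1)) := by
    have := hT m
    have := (groupHomologyEquiv T m).toEquiv.subsingleton
    exact (ModuleCat.isZero_of_subsingleton _).of_iso (groupHomologyIndTrivialIso T (m + 1))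
  exact isIso_δ_of_isZero hX (n + 1) (isZero_groupHomology_prodRep _ _ _ (hz hS₁ _) (hz hS₂ _))
    (isZero_groupHomology_prodRep _ _ _ (hz hS₁ _) (hz hS₂ _))

open Monoid PermRep in
lemma treeComplex_pushoutI_shortExact {k A : Type} [CommRing k] [Group A] {K : Bool → Type}
    [∀ b, Group (K b)] (φ : ∀ b, A →* K b) {S : Subgroup (PushoutI φ)}
    (hS : (PushoutI.base φ).range ≤ S) (h₁ : S ≤ (PushoutI.of (φ := φ) true).range)
    (h₂ : S ≤ (PushoutI.of (φ := φ) false).range) : (treeComplex k h₁ h₂).ShortExact := by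
  refine treeComplex_shortExact h₁ h₂ (PushoutI.range_of_sup_range_of φ) ?_
  obtain ⟨f₁, f₂, hf₁, hf₂, hf⟩ := PushoutI.exists_sub_eq_of_base_invariant (coset k S)
    fun a x => coset_mul (hS ⟨a, rfl⟩) x
  exact ⟨f₁, f₂, by rintro _ ⟨a, rfl⟩ x; exact hf₁ a x, by rintro _ ⟨a, rfl⟩ x; exact hf₂ a x, hf⟩

end

/-!
STATEMENT 9: Let K be a group with H̃_*(K;ℚ) = 0 (rationally acyclic), let G ≤ K be an
infinite cyclic subgroup, and let P = K *_G K be the amalgamated product.  Then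
H_n(P;ℚ) ≅ H_n(S²;ℚ) for all n:  H_0(P;ℚ) ≅ ℚ, H_2(P;ℚ) ≅ ℚ, and H_n(P;ℚ) = 0 for
n ∉ {0,2}.

Group homology with (trivial) rational coefficients is the homology of the bar complex
defined above: `GrpHomology.H X m` is `H_{m+1}(X;ℚ)` and `GrpHomology.H0 X` is `H_0(X;ℚ)`.
The amalgam `K *_G K` is `Monoid.PushoutI` of two copies of the inclusion of `G`, indexed
by `Bool`.  Note that rational acyclicity of `K` amounts to `H_{m+1}(K;ℚ) = 0` for all `m`,
since `H_0(X;ℚ) ≅ ℚ` holds for every group `X`.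
-/

open GrpHomology in
theorem homology_of_amalgam_over_infinite_cyclic
    (K : Type) [Group K]
    -- K is rationally acyclic: H̃_*(K;ℚ) = 0
    (hacyclic : ∀ m : ℕ, Subsingleton (H K m))
    -- G is an infinite cyclic subgroup of K
    (g : K) (hg : ¬IsOfFinOrder g) (G : Subgroup K) (hG : G = Subgroup.zpowers g) :
    -- H_*(K *_G K ; ℚ) ≅ H_*(S²;ℚ):
    Nonempty (H0 (Monoid.PushoutI (fun _ : Bool => G.subtype)) ≃ₗ[ℚ] ℚ)     -- H_0 ≅ ℚ
    ∧ Subsingleton (H (Monoid.PushoutI (fun _ : Bool => G.subtype)) 0)       -- H_1 = 0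
    ∧ Nonempty (H (Monoid.PushoutI (fun _ : Bool => G.subtype)) 1 ≃ₗ[ℚ] ℚ)  -- H_2 ≅ ℚ
    ∧ ∀ m : ℕ, 2 ≤ m →
        Subsingleton (H (Monoid.PushoutI (fun _ : Bool => G.subtype)) m)     -- H_n = 0, n ≥ 3
    := by
  refine ⟨⟨H0Equiv _⟩, subsingleton_H_zero_pushoutI _ fun _ => hacyclic 0, ?_⟩
  let φ : Bool → G →* K := fun _ => G.subtype
  have hφ (b : Bool) : Function.Injective (φ b) := G.subtype_injective
  let a : G := ⟨g, hG ▸ Subgroup.mem_zpowers g⟩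
  let p : Monoid.PushoutI φ := Monoid.PushoutI.base φ a
  have hp : ¬IsOfFinOrder p := fun h =>
    hg (G.subtype.isOfFinOrder ((Monoid.PushoutI.base_injective hφ).isOfFinOrder_iff.1 h))
  have hS : (Monoid.PushoutI.base φ).range ≤ Subgroup.zpowers p := by
    rintro _ ⟨⟨x, hx⟩, rfl⟩
    obtain ⟨n, rfl⟩ := Subgroup.mem_zpowers_iff.1 (hG ▸ hx)
    exact ⟨n, (map_zpow (Monoid.PushoutI.base φ) a n).symm⟩
  have hle (b : Bool) : Subgroup.zpowers p ≤ (Monoid.PushoutI.of (φ := φ) b).range :=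
    Subgroup.zpowers_le.2 ⟨φ b a, Monoid.PushoutI.of_apply_eq_base φ b a⟩
  have hac (b : Bool) (m : ℕ) : Subsingleton (H (Monoid.PushoutI.of (φ := φ) b).range m) :=
    subsingleton_H_of_mulEquiv (MonoidHom.ofInjective (Monoid.PushoutI.of_injective hφ b))
      (hacyclic m)
  have hX := treeComplex_pushoutI_shortExact (k := ℚ) φ hS (hle true) (hle false)
  have hδ := isIso_δ_treeComplex hX (hac true) (hac false)
  refine ⟨⟨?_⟩, fun m hm => ?_⟩
  · exact (groupHomologyEquiv (Monoid.PushoutI φ) 1).symm.trans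
      (@CategoryTheory.asIso _ _ _ _ _ (hδ 0) ≪≫
        PermRep.groupHomologyIndTrivialZpowersOneIso hp).toLinearEquiv
  · obtain ⟨n, rfl⟩ := Nat.exists_eq_add_of_le' hm
    have hz := (PermRep.isZero_groupHomology_indTrivial_zpowers hp n).of_iso
      (@CategoryTheory.asIso _ _ _ _ _ (hδ (n + 1)))
    exact @Equiv.subsingleton _ _ (groupHomologyEquiv _ (n + 2)).symm.toEquiv
      (ModuleCat.subsingleton_of_isZero hz)
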